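/- arXiv:1612.02367 — 3 statements merged into one kernel-verified Lean document; each statement's English description precedes it below -/
import Mathlib

section
/- Let ℓ > 0 and x ∈ ℝ with x ≠ 0 and |x| ≠ ℓ. Then the improper integral 2∫₀^M cos(2πxκ) · sin²(πℓκ)/κ dκ converges as M → ∞, and its limit equals −log|x| + (1/2)·log|ℓ² − x²|. -/
open MeasureTheory Real Filter intervalIntegral

lemma intervalIntegrable_inv_mul_of_differentiable {g : ℝ → ℝ} (hg : Differentiable ℝ g)
    (hg0 : g 0 = 0) (a b : ℝ) : IntervalIntegrable (fun t => t⁻¹ * g t) volume a b := by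
  have hc : Continuous (dslope g 0) := by
    rw [← continuousOn_univ, continuousOn_dslope univ_mem]
    exact ⟨hg.continuous.continuousOn, hg 0⟩
  refine (hc.intervalIntegrable a b).congr_ae (ae_restrict_of_ae ?_)
  filter_upwards [compl_mem_ae_iff.2 (measure_singleton (0 : ℝ))] with t ht
  rw [dslope_of_ne g ht, slope_def_field, hg0]
  ring

lemma tendsto_sin_mul_inv_atTop : Tendsto (fun t : ℝ => Real.sin t * t⁻¹) atTop (nhds 0) := by
  refine squeeze_zero_norm' ?_ tendsto_inv_atTop_zero
  filter_upwards [eventually_gt_atTop 0] with t ht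
  rw [norm_mul, norm_of_nonneg (inv_pos.2 ht).le]
  exact mul_le_of_le_one_left (inv_pos.2 ht).le (abs_sin_le_one t)

lemma tendsto_integral_inv_mul_cos_atTop {p q : ℝ} (hp : 0 < p) (hq : 0 < q) :
    Tendsto (fun M => ∫ t in (p * M)..(q * M), t⁻¹ * Real.cos t) atTop (nhds 0) := by
  have hloc : LocallyIntegrableOn (fun t : ℝ => Real.sin t * t⁻¹) (Set.Ioi 0) :=
    (continuous_sin.continuousOn.mul
      (continuousOn_inv₀.mono fun t ht => ne_of_gt ht)).locallyIntegrableOn measurableSet_Ioi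
  have h1 := Frullani.tendsto_integral_inv_smul_atTop hloc hp hq tendsto_sin_mul_inv_atTop
  have hb : ∀ {r : ℝ}, 0 < r →
      Tendsto (fun M : ℝ => Real.sin (r * M) * (r * M)⁻¹) atTop (nhds 0) := fun hr =>
    tendsto_sin_mul_inv_atTop.comp (tendsto_id.const_mul_atTop hr)
  have h2 := ((hb hq).sub (hb hp)).add h1
  simp only [smul_zero, sub_zero, add_zero] at h2
  refine h2.congr' ?_
  filter_upwards [eventually_gt_atTop 0] with M hM
  have hne : ∀ t ∈ Set.uIcc (p * M) (q * M), t ≠ 0 := fun t ht =>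
    ((lt_min (mul_pos hp hM) (mul_pos hq hM)).trans_le ht.1).ne'
  have hparts := integral_mul_deriv_eq_deriv_mul (a := p * M) (b := q * M)
    (u := fun t : ℝ => t⁻¹) (u' := fun t => -(t ^ 2)⁻¹) (v := Real.sin) (v' := Real.cos)
    (fun t ht => hasDerivAt_inv (hne t ht)) (fun t _ => hasDerivAt_sin t)
    (ContinuousOn.intervalIntegrable
      (((continuous_pow 2).continuousOn.inv₀ fun t ht => pow_ne_zero 2 (hne t ht)).neg))
    (continuous_cos.intervalIntegrable _ _)
  rw [hparts]
  have : ∀ t : ℝ, -(t ^ 2)⁻¹ * Real.sin t = -(t⁻¹ • (Real.sin t * t⁻¹)) := fun t => by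
    rw [smul_eq_mul, sq, mul_inv]; ring
  simp only [this, intervalIntegral.integral_neg]
  ring

/-- The interval integrals of `(cos (p t) - cos (q t)) / t` converge to `log (q / p)`. -/
lemma tendsto_integral_inv_mul_cos_sub_cos {p q : ℝ} (hp : 0 < p) (hq : 0 < q) :
    Tendsto (fun M => ∫ t in (0 : ℝ)..M, t⁻¹ * (Real.cos (p * t) - Real.cos (q * t))) atTop
      (nhds (Real.log (q / p))) := by
  have hint := intervalIntegrable_inv_mul_of_differentiable
    (g := fun t => Real.cos (p * t) - Real.cos (q * t)) (by fun_prop) (by simp)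
  have hloc : LocallyIntegrableOn Real.cos (Set.Ioi 0) :=
    continuous_cos.locallyIntegrable.locallyIntegrableOn _
  have hL : Tendsto Real.cos (nhdsWithin 0 (Set.Ioi 0)) (nhds 1) := by
    simpa using (continuous_cos.tendsto 0).mono_left nhdsWithin_le_nhds
  have hzero := Frullani.tendsto_integral_inv_smul_nhdsWithin hloc hp hq hL
  simp only [smul_eq_mul, mul_one] at hzero
  have hlim := tendsto_integral_inv_mul_cos_atTop hp hq
  have h := hlim.const_sub (Real.log (q / p))
  rw [sub_zero] at h
  refine h.congr' ?_
  filter_upwards [eventually_gt_atTop 0] with M hM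
  have hu : ∀ {a b : ℝ}, 0 < a → 0 < b →
      IntervalIntegrable (fun t => t⁻¹ * Real.cos t) volume a b := fun ha hb =>
    Frullani.intervalIntegrable_inv_smul hloc ha hb
  have hprim : Tendsto (fun ε => ∫ t in ε..M, t⁻¹ * (Real.cos (p * t) - Real.cos (q * t)))
      (nhdsWithin 0 (Set.Ioi 0))
      (nhds (∫ t in (0 : ℝ)..M, t⁻¹ * (Real.cos (p * t) - Real.cos (q * t)))) := by
    have := ((continuous_primitive hint M).neg.tendsto 0).mono_left
      (nhdsWithin_le_nhds (s := Set.Ioi 0))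
    simpa only [Pi.neg_def, ← integral_symm] using this
  refine tendsto_nhds_unique ((hzero.sub_const _).congr' ?_) hprim
  filter_upwards [self_mem_nhdsWithin] with ε hε
  have hε : 0 < ε := hε
  have h1 := Frullani.integral_comp_mul_inv_smul (f := Real.cos) (ε := ε) (r := M) hp.ne'
  have h2 := Frullani.integral_comp_mul_inv_smul (f := Real.cos) (ε := ε) (r := M) hq.ne'
  have i1 := Frullani.intervalIntegrable_inv_smul_comp_mul hloc hε hM hp
  have i2 := Frullani.intervalIntegrable_inv_smul_comp_mul hloc hε hM hq
  simp only [smul_eq_mul] at h1 h2 i1 i2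
  simp only [mul_sub]
  rw [integral_sub i1 i2, h1, h2]
  exact (integral_interval_sub_interval_comm (hu (mul_pos hp hε) (mul_pos hp hM))
    (hu (mul_pos hq hε) (mul_pos hq hM)) (hu (mul_pos hp hε) (mul_pos hq hε))).symm

/-- For `ℓ > 0` and `x ≠ 0` with `|x| ≠ ℓ`, the improper integral
`2∫₀^∞ cos(2πxκ) sin²(πℓκ)/κ dκ` converges and equals `-log|x| + (1/2) log|ℓ² - x²|`. -/
theorem cosine_sine_log_integral (ℓ x : ℝ) (hℓ : 0 < ℓ) (hx : x ≠ 0) (hxℓ : |x| ≠ ℓ) :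
    Tendsto
      (fun M : ℝ =>
        ∫ κ in (0 : ℝ)..M, 2 * Real.cos (2 * π * x * κ) * Real.sin (π * ℓ * κ) ^ 2 / κ)
      atTop (nhds (-Real.log |x| + Real.log |ℓ ^ 2 - x ^ 2| / 2)) := by
  have hadd : x + ℓ ≠ 0 := fun h => hxℓ (by
    rw [eq_neg_of_add_eq_zero_left h, abs_neg, abs_of_pos hℓ])
  have hsub : x - ℓ ≠ 0 := fun h => hxℓ (by rw [sub_eq_zero.1 h, abs_of_pos hℓ])
  have hpos : ∀ {y : ℝ}, y ≠ 0 → 0 < |2 * π * y| := fun hy =>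
    abs_pos.2 (mul_ne_zero two_pi_pos.ne' hy)
  have hcos : ∀ y t : ℝ, Real.cos (|y| * t) = Real.cos (y * t) := fun y t => by
    rcases abs_choice y with h | h <;> simp [h]
  have h := ((tendsto_integral_inv_mul_cos_sub_cos (hpos hx) (hpos hadd)).add
    (tendsto_integral_inv_mul_cos_sub_cos (hpos hx) (hpos hsub))).const_mul (1 / 2)
  simp only [hcos] at h
  convert h using 2
  · rw [← intervalIntegral.integral_add, ← intervalIntegral.integral_const_mul]
    · congr 1
      ext t
      have e1 : 2 * π * (x + ℓ) * t = 2 * π * x * t + 2 * (π * ℓ * t) := by ring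
      have e2 : 2 * π * (x - ℓ) * t = 2 * π * x * t - 2 * (π * ℓ * t) := by ring
      rw [e1, e2, Real.cos_add, Real.cos_sub, Real.cos_two_mul, Real.cos_sq']
      ring
    all_goals exact intervalIntegrable_inv_mul_of_differentiable (by fun_prop) (by simp) _ _
  · have hfac : ℓ ^ 2 - x ^ 2 = -((x + ℓ) * (x - ℓ)) := by ring
    have hpi := two_pi_pos.ne'
    rw [hfac, ← abs_div, ← abs_div, mul_div_mul_left _ _ hpi, mul_div_mul_left _ _ hpi]
    simp only [log_abs, log_neg_eq_log]
    rw [log_mul hadd hsub, log_div hadd hx, log_div hsub hx]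
    ring
end

section
/- Let Φ : (0,∞) → ℝ be integrable on (0,∞), continuous with Φ(0⁺) = 1, and such that κ ↦ (Φ(κ) − 1_{κ≤1})/κ is integrable on (0,∞). Then the function ℰ_Φ is continuously differentiable on ℝ with ℰ_Φ′(ω) = ∫₀^∞ sin(ωκ) (Φ(κ) − 1_{κ≤1}) dκ, and lim_{ω→∞} ℰ_Φ(ω) = ∫₀^∞ (Φ(κ) − 1_{κ≤1})/κ dκ. -/
open MeasureTheory Real Filter

/-- `ℰ_Φ(ω) = ∫₀^∞ (1 - cos(ωκ)) (Φ(κ) - 1_{κ≤1})/κ dκ`. -/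
noncomputable def Ephi (Φ : ℝ → ℝ) (ω : ℝ) : ℝ :=
  ∫ κ in Set.Ioi (0 : ℝ),
    (1 - Real.cos (ω * κ)) * ((Φ κ - if κ ≤ 1 then 1 else 0) / κ)

/-- The Riemann-Lebesgue lemma for cosine integrals of real functions. -/
theorem tendsto_integral_cos_mul_atTop {f : ℝ → ℝ} (hf : Integrable f) :
    Tendsto (fun ω : ℝ => ∫ κ, Real.cos (ω * κ) * f κ) atTop (nhds 0) := by
  have hscale : Tendsto (fun ω : ℝ => ω / (2 * π)) atTop (cocompact ℝ) :=
    (tendsto_id.atTop_div_const (by positivity)).mono_right atTop_le_cocompact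
  have hlim := (Real.tendsto_integral_exp_smul_cocompact (fun κ => (f κ : ℂ))).comp hscale
  have hre := (Complex.continuous_re.tendsto 0).comp hlim
  refine hre.congr fun ω => ?_
  have hint := (Real.fourierIntegral_convergent_iff (ω / (2 * π))).2 (hf.ofReal (𝕜 := ℂ))
  simp only [Function.comp_apply]
  rw [← Complex.reCLM_apply, ← ContinuousLinearMap.integral_comp_comm]
  · refine integral_congr_ae (Eventually.of_forall fun κ => ?_)
    have harg : 2 * π * (-(κ * (ω / (2 * π)))) = -(ω * κ) := by
      field_simp
    simp only [Complex.reCLM_apply, Circle.smul_def, Real.fourierChar_apply, smul_eq_mul, harg,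
      Complex.re_mul_ofReal, Complex.exp_ofReal_mul_I_re, Real.cos_neg]
  · simpa [mul_comm] using hint

/-- The Riemann-Lebesgue lemma for cosine integrals over a measurable set. -/
theorem tendsto_setIntegral_cos_mul_atTop {f : ℝ → ℝ} {s : Set ℝ} (hs : MeasurableSet s)
    (hf : IntegrableOn f s) :
    Tendsto (fun ω : ℝ => ∫ κ in s, Real.cos (ω * κ) * f κ) atTop (nhds 0) := by
  refine (tendsto_integral_cos_mul_atTop (hf.integrable_indicator hs)).congr fun ω => ?_
  rw [← integral_indicator hs]
  congr 1 with κ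
  by_cases hκ : κ ∈ s <;> simp [hκ]

theorem integrableOn_Ioi_sub_ite_le_one {Φ : ℝ → ℝ} (hΦ : IntegrableOn Φ (Set.Ioi 0)) :
    IntegrableOn (fun κ => Φ κ - if κ ≤ 1 then 1 else 0) (Set.Ioi 0) := by
  refine hΦ.sub ?_
  have h : IntegrableOn ((Set.Iic (1 : ℝ)).indicator fun _ => (1 : ℝ)) (Set.Ioi 0) := by
    rw [integrableOn_indicator_iff measurableSet_Iic, Set.inter_comm, Set.Ioi_inter_Iic]
    simp
  exact h

/-- If `Φ` is integrable on `(0,∞)`, continuous with `Φ(0⁺) = 1`, and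
`κ ↦ (Φ(κ) - 1_{κ≤1})/κ` is integrable on `(0,∞)`, then `ℰ_Φ` is continuously differentiable
with `ℰ_Φ'(ω) = ∫₀^∞ sin(ωκ)(Φ(κ) - 1_{κ≤1}) dκ`, and
`ℰ_Φ(ω) → ∫₀^∞ (Φ(κ) - 1_{κ≤1})/κ dκ` as `ω → ∞`. -/
theorem Ephi_differentiable_and_limit (Φ : ℝ → ℝ)
    (hΦint : IntegrableOn Φ (Set.Ioi 0))
    (hΦcont : ContinuousOn Φ (Set.Ioi 0))
    (hΦ0 : Tendsto Φ (nhdsWithin 0 (Set.Ioi 0)) (nhds 1))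
    (hquot : IntegrableOn (fun κ => (Φ κ - if κ ≤ 1 then 1 else 0) / κ) (Set.Ioi 0)) :
    (∀ ω : ℝ, HasDerivAt (Ephi Φ)
        (∫ κ in Set.Ioi (0 : ℝ), Real.sin (ω * κ) * (Φ κ - if κ ≤ 1 then 1 else 0)) ω) ∧
    Continuous (fun ω : ℝ =>
        ∫ κ in Set.Ioi (0 : ℝ), Real.sin (ω * κ) * (Φ κ - if κ ≤ 1 then 1 else 0)) ∧
    Tendsto (Ephi Φ) atTop
      (nhds (∫ κ in Set.Ioi (0 : ℝ), (Φ κ - if κ ≤ 1 then 1 else 0) / κ)) := by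
  have hg := integrableOn_Ioi_sub_ite_le_one hΦint
  have hcos (ω : ℝ) : IntegrableOn
      (fun κ => Real.cos (ω * κ) * ((Φ κ - if κ ≤ 1 then 1 else 0) / κ)) (Set.Ioi 0) :=
    hquot.bdd_mul (c := 1) (by fun_prop)
      (Eventually.of_forall fun κ => Real.abs_cos_le_one (ω * κ))
  have hF (ω : ℝ) : IntegrableOn
      (fun κ => (1 - Real.cos (ω * κ)) * ((Φ κ - if κ ≤ 1 then 1 else 0) / κ)) (Set.Ioi 0) := by
    simp only [sub_mul, one_mul]
    exact Integrable.sub hquot (hcos ω)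
  have hmeas (ω : ℝ) : AEStronglyMeasurable
      (fun κ => Real.sin (ω * κ) * (Φ κ - if κ ≤ 1 then 1 else 0))
      (volume.restrict (Set.Ioi 0)) :=
    AEStronglyMeasurable.mul (by fun_prop) hg.aestronglyMeasurable
  have hbound (ω κ : ℝ) : ‖Real.sin (ω * κ) * (Φ κ - if κ ≤ 1 then 1 else 0)‖ ≤
      ‖Φ κ - if κ ≤ 1 then 1 else 0‖ := by
    rw [norm_mul]
    exact mul_le_of_le_one_left (norm_nonneg _) (Real.abs_sin_le_one _)
  refine ⟨fun ω => ?_, ?_, ?_⟩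
  · refine (hasDerivAt_integral_of_dominated_loc_of_deriv_le univ_mem
      (Eventually.of_forall fun x => (hF x).aestronglyMeasurable) (hF ω) (hmeas ω)
      (Eventually.of_forall fun κ x _ => hbound x κ) hg.norm ?_).2
    filter_upwards [ae_restrict_mem measurableSet_Ioi] with κ hκ x _
    have hκ0 : κ ≠ 0 := ne_of_gt hκ
    have hderiv := ((((hasDerivAt_id x).mul_const κ).cos).const_sub 1).mul_const
      ((Φ κ - if κ ≤ 1 then 1 else 0) / κ)
    refine hderiv.congr_deriv ?_
    simp only [id_eq]
    field_simp
  · exact continuous_of_dominated hmeas (fun ω => Eventually.of_forall (hbound ω)) hg.norm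
      (Eventually.of_forall fun κ => by fun_prop)
  · have hlim := (tendsto_setIntegral_cos_mul_atTop measurableSet_Ioi hquot).const_sub
      (∫ κ in Set.Ioi (0 : ℝ), (Φ κ - if κ ≤ 1 then 1 else 0) / κ)
    rw [sub_zero] at hlim
    refine hlim.congr fun ω => ?_
    rw [Ephi, ← integral_sub hquot (hcos ω)]
    simp only [sub_mul, one_mul]
end

section
/- (Andréief identity) Let (Σ, μ) be a measure space, N ≥ 1 an integer, and f₁,…,f_N, g₁,…,g_N : Σ → ℂ measurable functions such that f_j · g_k ∈ L¹(μ) for all 1 ≤ j, k ≤ N. Then (1/N!) ∫_{Σ^N} det( f_j(x_k) )_{j,k=1}^N · det( g_j(x_k) )_{j,k=1}^N dμ(x₁)⋯dμ(x_N) = det( ∫_Σ f_j(x) g_k(x) dμ(x) )_{j,k=1}^N. -/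
open MeasureTheory

/-- The integral of a product of two determinants of functions, over a finite power of a
σ-finite measure space. -/
theorem integral_det_mul_det {ι S : Type*} [Fintype ι] [DecidableEq ι] [MeasurableSpace S]
    (μ : Measure S) [SigmaFinite μ] (f g : ι → S → ℂ)
    (hfg : ∀ j k, Integrable (fun x => f j x * g k x) μ) :
    ∫ x : ι → S, Matrix.det (Matrix.of fun j k => f j (x k)) *
        Matrix.det (Matrix.of fun j k => g j (x k)) ∂(Measure.pi fun _ => μ) =
      (Fintype.card ι).factorial * Matrix.det (Matrix.of fun j k => ∫ x, f j x * g k x ∂μ) := by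
  have expand (x : ι → S) : Matrix.det (Matrix.of fun j k => f j (x k)) *
      Matrix.det (Matrix.of fun j k => g j (x k)) =
      ∑ τ : Equiv.Perm ι, ∑ σ : Equiv.Perm ι, ((Equiv.Perm.sign τ : ℤ) : ℂ) *
        (((Equiv.Perm.sign σ : ℤ) : ℂ) * ∏ i, f (σ i) (x i) * g (τ i) (x i)) := by
    rw [Matrix.det_apply', Matrix.det_apply', Finset.sum_mul_sum, Finset.sum_comm]
    refine Finset.sum_congr rfl fun τ _ => Finset.sum_congr rfl fun σ _ => ?_
    simp only [Matrix.of_apply, Finset.prod_mul_distrib]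
    ring
  have integrable (τ σ : Equiv.Perm ι) : Integrable (fun x : ι → S =>
      ((Equiv.Perm.sign τ : ℤ) : ℂ) *
        (((Equiv.Perm.sign σ : ℤ) : ℂ) * ∏ i, f (σ i) (x i) * g (τ i) (x i)))
      (Measure.pi fun _ => μ) :=
    ((Integrable.fintype_prod fun i => hfg (σ i) (τ i)).const_mul _).const_mul _
  simp_rw [expand]
  rw [integral_finsetSum _ fun τ _ => integrable_finsetSum _ fun σ _ => integrable τ σ]
  set M : Matrix ι ι ℂ := Matrix.of fun j k => ∫ x, f j x * g k x ∂μ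
  have inner (τ : Equiv.Perm ι) : ∫ x : ι → S, ∑ σ : Equiv.Perm ι,
      ((Equiv.Perm.sign τ : ℤ) : ℂ) *
        (((Equiv.Perm.sign σ : ℤ) : ℂ) * ∏ i, f (σ i) (x i) * g (τ i) (x i))
        ∂(Measure.pi fun _ => μ) = M.det := by
    rw [integral_finsetSum _ fun σ _ => integrable τ σ]
    have fubini (σ : Equiv.Perm ι) :
        ∫ x : ι → S, ∏ i, f (σ i) (x i) * g (τ i) (x i) ∂(Measure.pi fun _ => μ) =
          ∏ i, M.submatrix id τ (σ i) i :=
      integral_fintype_prod_eq_prod fun i y => f (σ i) y * g (τ i) y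
    simp_rw [integral_const_mul, fubini]
    rw [← Finset.mul_sum, ← Matrix.det_apply', Matrix.det_permute', ← mul_assoc, ← Int.cast_mul,
      Int.units_coe_mul_self, Int.cast_one, one_mul]
  simp [inner, Fintype.card_perm]

/-- **Andréief identity.** For measurable `f₁,…,f_N, g₁,…,g_N : Σ → ℂ` with `f_j g_k`
integrable for all `j, k`,
`(1/N!) ∫_{Σ^N} det(f_j(x_k)) det(g_j(x_k)) dμ^{⊗N} = det(∫ f_j g_k dμ)`. -/
theorem andreief_identity {S : Type*} [MeasurableSpace S] (μ : Measure S) [SigmaFinite μ]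
    (N : ℕ) (hN : 1 ≤ N) (f g : Fin N → S → ℂ)
    (hf : ∀ j, Measurable (f j)) (hg : ∀ j, Measurable (g j))
    (hfg : ∀ j k, Integrable (fun x => f j x * g k x) μ) :
    (1 / N.factorial : ℂ) *
        ∫ x : Fin N → S,
          Matrix.det (Matrix.of fun j k : Fin N => f j (x k)) *
            Matrix.det (Matrix.of fun j k : Fin N => g j (x k))
          ∂(Measure.pi fun _ : Fin N => μ) =
      Matrix.det (Matrix.of fun j k : Fin N => ∫ x, f j x * g k x ∂μ) := by
  have : (N.factorial : ℂ) ≠ 0 := Nat.cast_ne_zero.mpr N.factorial_ne_zero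
  rw [integral_det_mul_det μ f g hfg, Fintype.card_fin]
  field_simp
end
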